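/- arXiv:math/0605294 — 2 statements merged into one kernel-verified Lean document; each statement's English description precedes it below -/
import Mathlib

section
/- Let f be the Perron vector of a connected finite simple graph G with degree sequence π. Suppose there are vertices u, v, x with vu ∈ E(G), vx ∉ E(G), and f(u) < f(x) ≤ f(v). If additionally f(v) ≥ f(w) for all neighbors w of x, then G does not have greatest spectral radius in the class C_π of all connected graphs with degree sequence π; that is, there exists a connected graph G' with the same degree sequence π and λ(G') > λ(G). -/
open Finset

variable {V : Type*} {W : Type*}

/-- The adjacency matrix of a finite simple graph, with real entries. -/
noncomputable def adjMat [Fintype V] (G : SimpleGraph V) : Matrix V V ℝ :=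
  letI := Classical.decRel G.Adj
  G.adjMatrix ℝ

/-- The spectral radius `λ(G)`: the largest eigenvalue of the adjacency matrix. -/
noncomputable def specRad [Fintype V] (G : SimpleGraph V) : ℝ :=
  sSup {μ : ℝ | ∃ f : V → ℝ, f ≠ 0 ∧ (adjMat G).mulVec f = μ • f}

/-- The degree of a vertex. -/
noncomputable def deg [Fintype V] (G : SimpleGraph V) (v : V) : ℕ :=
  letI := Classical.decRel G.Adj
  G.degree v

/-- The degree sequence of `G`, as a multiset. -/
noncomputable def degMultiset [Fintype V] (G : SimpleGraph V) : Multiset ℕ :=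
  Finset.univ.val.map (deg G)

/-- `G` has the degree sequence `d` (a sequence of length `n`). -/
def hasDegSeq [Fintype V] (G : SimpleGraph V) {n : ℕ} (d : Fin n → ℕ) : Prop :=
  Finset.univ.val.map d = degMultiset G

/-- `f` is the Perron vector of `G`: a positive unit eigenvector for the
largest eigenvalue. -/
def IsPerronVector [Fintype V] (G : SimpleGraph V) (f : V → ℝ) : Prop :=
  (∀ v, 0 < f v) ∧ (∑ v, f v ^ 2 = 1) ∧ (adjMat G).mulVec f = specRad G • f

/-- `N_f(v) = Σ_{u ∼ v} f(u)`. -/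
noncomputable def Nf [Fintype V] (G : SimpleGraph V) (f : V → ℝ) (v : V) : ℝ :=
  letI := Classical.decRel G.Adj
  ∑ u ∈ G.neighborFinset v, f u

/-- `w` is the parent of `v` w.r.t. the ordering `ord` (with root `ord.symm 0`):
`w` is the `ord`-least neighbor of `v` whose height is one less than that of `v`. -/
def IsParent [Fintype V] [Nonempty V] (G : SimpleGraph V)
    (ord : V ≃ Fin (Fintype.card V)) (w v : V) : Prop :=
  G.Adj w v ∧ G.dist (ord.symm ⟨0, Fintype.card_pos⟩) w + 1
      = G.dist (ord.symm ⟨0, Fintype.card_pos⟩) v ∧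
    ∀ w' : V, G.Adj w' v →
      G.dist (ord.symm ⟨0, Fintype.card_pos⟩) w' + 1
        = G.dist (ord.symm ⟨0, Fintype.card_pos⟩) v → ord w ≤ ord w'

/-- `ord` is a breadth-first search ordering with decreasing degrees (BFD-ordering):
vertices are listed layer by layer by distance from the root (the `ord`-least vertex),
(B1) children of earlier parents come before children of later parents, and
(B2) earlier vertices have larger or equal degrees. -/
def IsBFDOrdering [Fintype V] [Nonempty V] (G : SimpleGraph V)
    (ord : V ≃ Fin (Fintype.card V)) : Prop :=
  (∀ u v : V, ord u ≤ ord v →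
      G.dist (ord.symm ⟨0, Fintype.card_pos⟩) u
        ≤ G.dist (ord.symm ⟨0, Fintype.card_pos⟩) v) ∧
  (∀ w1 w2 v1 v2 : V, ord w1 < ord w2 →
      IsParent G ord w1 v1 → IsParent G ord w2 v2 → ord v1 < ord v2) ∧
  (∀ u v : V, ord u < ord v → deg G v ≤ deg G u)

/-- A tree degree sequence: non-increasing, positive entries, summing to `2(n-1)`. -/
def IsTreeDegSeq {n : ℕ} (d : Fin n → ℕ) : Prop :=
  Antitone d ∧ (∀ i, 0 < d i) ∧ ∑ i, d i = 2 * (n - 1)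

/-- `Σ_{uv ∈ E(G)} f(u) f(v)`. -/
noncomputable def edgeSum [Fintype V] [DecidableEq V] (G : SimpleGraph V) (f : V → ℝ) : ℝ :=
  letI := Classical.decRel G.Adj
  ∑ e ∈ G.edgeFinset, Sym2.lift ⟨fun u v => f u * f v, fun u v => mul_comm (f u) (f v)⟩ e

/-- The graph obtained from `G` by switching: replacing edges `v1u1`, `v2u2`
by `v1v2`, `u1u2`. -/
noncomputable def switched (G : SimpleGraph V) (v1 u1 v2 u2 : V) : SimpleGraph V :=
  SimpleGraph.fromEdgeSet ((G.edgeSet \ {s(v1, u1), s(v2, u2)}) ∪ {s(v1, v2), s(u1, u2)})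

/-- The graph obtained from `G` by shifting: replacing the edge `uv1` by `uv2`. -/
noncomputable def shifted (G : SimpleGraph V) (u v1 v2 : V) : SimpleGraph V :=
  SimpleGraph.fromEdgeSet ((G.edgeSet \ {s(u, v1)}) ∪ {s(u, v2)})

/-- Switching keeps the graph connected when it keeps the ends of the removed edges connected. -/
lemma switched_connected {G : SimpleGraph V} (hconn : G.Connected) {v u x w : V}
    (h₁ : (switched G v u x w).Reachable v u) (h₂ : (switched G v u x w).Reachable x w) :
    (switched G v u x w).Connected := by
  have hadj : ∀ a b, G.Adj a b → (switched G v u x w).Reachable a b := by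
    intro a b hab
    by_cases h : s(a, b) = s(v, u)
    · rcases Sym2.eq_iff.1 h with ⟨rfl, rfl⟩ | ⟨rfl, rfl⟩
      exacts [h₁, h₁.symm]
    by_cases h' : s(a, b) = s(x, w)
    · rcases Sym2.eq_iff.1 h' with ⟨rfl, rfl⟩ | ⟨rfl, rfl⟩
      exacts [h₂, h₂.symm]
    refine SimpleGraph.Adj.reachable ?_
    rw [switched, SimpleGraph.fromEdgeSet_adj]
    exact ⟨Or.inl ⟨hab, by simp [h, h']⟩, hab.ne⟩
  have := hconn.nonempty
  refine ⟨fun a b => ?_⟩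
  obtain ⟨p⟩ := hconn a b
  induction p with
  | nil => exact SimpleGraph.Reachable.refl _
  | cons h _ ih => exact (hadj _ _ h).trans ih

/-- A walk of `G` avoiding both removed edges survives the switching. -/
lemma switched_reachable_of_walk {G : SimpleGraph V} {v u x w a b : V} (p : G.Walk a b)
    (h₁ : s(v, u) ∉ p.edges) (h₂ : s(x, w) ∉ p.edges) :
    (switched G v u x w).Reachable a b := by
  refine ⟨p.transfer _ fun e he => ?_⟩
  rw [switched, SimpleGraph.edgeSet_fromEdgeSet]
  have heG := p.edges_subset_edgeSet he
  refine ⟨Or.inl ⟨heG, ?_⟩, G.not_isDiag_of_mem_edgeSet heG⟩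
  rintro (rfl | rfl)
  exacts [h₁ he, h₂ he]

lemma adjMat_apply [Fintype V] (G : SimpleGraph V) [DecidableRel G.Adj] (a b : V) :
    adjMat G a b = if G.Adj a b then 1 else 0 := by
  simp [adjMat, SimpleGraph.adjMatrix_apply]

lemma adjMat_mulVec_one [Fintype V] (G : SimpleGraph V) (a : V) :
    (adjMat G).mulVec (fun _ => 1) a = deg G a := by
  classical
  simp [Matrix.mulVec, dotProduct, adjMat_apply, deg, ← SimpleGraph.card_neighborFinset_eq_degree,
    SimpleGraph.neighborFinset_eq_filter]

lemma adjMat_isHermitian [Fintype V] (G : SimpleGraph V) : (adjMat G).IsHermitian := by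
  classical
  ext a b
  simp [adjMat_apply, G.adj_comm]

lemma adjMat_mulVec_switched [Fintype V] [DecidableEq V] {G : SimpleGraph V} {v u x w : V}
    (hvu : G.Adj v u) (hxw : G.Adj x w) (hvx : ¬ G.Adj v x) (huw : ¬ G.Adj u w)
    (hxv : x ≠ v) (hxu : x ≠ u) (hwu : w ≠ u) (g : V → ℝ) :
    (adjMat (switched G v u x w)).mulVec g = (adjMat G).mulVec g
      + (Pi.single v (g x - g u) + Pi.single u (g w - g v)
        + Pi.single x (g v - g w) + Pi.single w (g u - g x)) := by
  classical
  have hvw : v ≠ w := by rintro rfl; exact hvx hxw.symm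
  have hvu' := hvu.ne
  have hxw' := hxw.ne
  have hentry : ∀ a b, adjMat (switched G v u x w) a b = adjMat G a b
      + ((if a = v then ((if b = x then 1 else 0) - (if b = u then 1 else 0)) else 0)
      + (if a = u then ((if b = w then 1 else 0) - (if b = v then 1 else 0)) else 0)
      + (if a = x then ((if b = v then 1 else 0) - (if b = w then 1 else 0)) else 0)
      + (if a = w then ((if b = u then 1 else 0) - (if b = x then 1 else 0)) else 0)) := by
    intro a b
    have hadj : (switched G v u x w).Adj a b ↔
        ((G.Adj a b ∧ ¬ s(a, b) = s(v, u) ∧ ¬ s(a, b) = s(x, w)) ∨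
          s(a, b) = s(v, x) ∨ s(a, b) = s(u, w)) ∧ a ≠ b := by
      simp only [switched, SimpleGraph.fromEdgeSet_adj, Set.mem_union, Set.mem_sdiff,
        Set.mem_insert_iff, Set.mem_singleton_iff, SimpleGraph.mem_edgeSet, not_or]
    have hirr := fun c => G.irrefl (v := c)
    have hsymm := fun c d => G.adj_comm c d
    simp only [adjMat_apply, hadj, Sym2.eq_iff]
    by_cases h1 : a = v
    · subst h1; grind
    by_cases h2 : a = u
    · subst h2; grind
    by_cases h3 : a = x
    · subst h3; grind
    by_cases h4 : a = w
    · subst h4; grind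
    have := fun h : G.Adj a b => h.ne
    simp [h1, h2, h3, h4]
    grind
  ext a
  simp only [Matrix.mulVec, dotProduct, hentry, add_mul, Finset.sum_add_distrib, Pi.add_apply,
    Pi.single_apply, ite_mul, sub_mul, zero_mul, one_mul]
  congr 1
  congr 1
  · congr 1
    · congr 1 <;> split_ifs <;> simp [Finset.sum_sub_distrib]
    · split_ifs <;> simp [Finset.sum_sub_distrib]
  · split_ifs <;> simp [Finset.sum_sub_distrib]

lemma le_specRad [Fintype V] (G : SimpleGraph V) {μ : ℝ} {g : V → ℝ} (hg : g ≠ 0)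
    (h : (adjMat G).mulVec g = μ • g) : μ ≤ specRad G := by
  classical
  refine le_csSup (Set.Finite.bddAbove ?_) ⟨g, hg, h⟩
  refine (Module.End.finite_hasEigenvalue (Matrix.toLin' (adjMat G))).subset ?_
  rintro ν ⟨k, hk, hν⟩
  exact Module.End.hasEigenvalue_of_hasEigenvector
    ⟨Module.End.mem_eigenspace_iff.2 (by simpa using hν), hk⟩

/-- A vector whose Rayleigh quotient is at least `c ≥ specRad G` is an eigenvector for `c`. -/
lemma mulVec_eq_of_specRad_le [Fintype V] (G : SimpleGraph V) {c : ℝ} (hc : specRad G ≤ c)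
    {g : V → ℝ} (hg : c * (g ⬝ᵥ g) ≤ g ⬝ᵥ (adjMat G).mulVec g) :
    (adjMat G).mulVec g = c • g := by
  classical
  have hM : ∀ k : V → ℝ, (c • (1 : Matrix V V ℝ) - adjMat G).mulVec k
      = c • k - (adjMat G).mulVec k := by
    intro k
    rw [Matrix.sub_mulVec, Matrix.smul_mulVec, Matrix.one_mulVec]
  have hH : (c • (1 : Matrix V V ℝ) - adjMat G).IsHermitian := by
    refine Matrix.IsHermitian.sub ?_ (adjMat_isHermitian G)
    simp [Matrix.IsHermitian]
  have hpsd : (c • (1 : Matrix V V ℝ) - adjMat G).PosSemidef := by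
    rw [hH.posSemidef_iff_eigenvalues_nonneg]
    intro i
    have hev := hH.mulVec_eigenvectorBasis i
    rw [hM] at hev
    have hne : (⇑(hH.eigenvectorBasis i) : V → ℝ) ≠ 0 := by
      intro h0
      apply hH.eigenvectorBasis.orthonormal.ne_zero i
      ext j
      exact congrFun h0 j
    have := le_specRad G (μ := c - hH.eigenvalues i) hne (by
      rw [sub_smul, ← hev]; abel)
    simp only [Pi.zero_apply]
    linarith
  have hnn := hpsd.dotProduct_mulVec_nonneg g
  have hz := (hpsd.dotProduct_mulVec_zero_iff g).1 (by
    refine le_antisymm ?_ hnn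
    simp only [hM, star_trivial, dotProduct_sub, dotProduct_smul, smul_eq_mul]
    linarith)
  rw [hM] at hz
  exact (sub_eq_zero.1 hz).symm

lemma adjMat_mulVec_eq_sum [Fintype V] (G : SimpleGraph V) [DecidableRel G.Adj]
    (g : V → ℝ) (a : V) :
    (adjMat G).mulVec g a = ∑ b ∈ univ.filter (G.Adj a), g b := by
  simp [Matrix.mulVec, dotProduct, adjMat_apply, Finset.sum_filter]

/-- A vertex `x` with larger Perron weight than `u` has, besides any given neighbor `y` of weight
at most that of a private neighbor `v` of `u`, another neighbor outside the closed
neighborhood of `u`. -/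
lemma exists_neighbor_ne [Fintype V] {G : SimpleGraph V}
    {f : V → ℝ} (hf : IsPerronVector G f) {u v x : V}
    (hxv : x ≠ v) (hvu : G.Adj v u) (hvx : ¬ G.Adj v x) (hux : f u < f x)
    {y : V} (hy : f y ≤ f v) :
    ∃ w, G.Adj x w ∧ ¬ G.Adj u w ∧ w ≠ u ∧ w ≠ y := by
  classical
  obtain ⟨hpos, -, heig⟩ := hf
  have hrad : 0 ≤ specRad G := by
    have h := congrFun heig u
    rw [adjMat_mulVec_eq_sum, Pi.smul_apply, smul_eq_mul] at h
    have h2 : 0 ≤ specRad G * f u := h ▸ Finset.sum_nonneg fun b _ => (hpos b).le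
    exact nonneg_of_mul_nonneg_left h2 (hpos u)
  by_contra! hcon
  have hx := congrFun heig x
  have hu := congrFun heig u
  rw [adjMat_mulVec_eq_sum, Pi.smul_apply, smul_eq_mul] at hx hu
  have hle : specRad G * f u ≤ specRad G * f x := mul_le_mul_of_nonneg_left hux.le hrad
  set s := univ.filter (G.Adj x)
  set t := univ.filter (G.Adj u)
  have hvt : v ∈ t := by simp [t, hvu.symm]
  have hvs : v ∉ s := by simpa [s, G.adj_comm] using hvx
  have key : ∑ b ∈ s, f b + f x < ∑ b ∈ t, f b + f u → False := by
    intro h; rw [hx, hu] at h; linarith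
  have hs : ∑ b ∈ s \ t, f b - ∑ b ∈ t \ s, f b = ∑ b ∈ s, f b - ∑ b ∈ t, f b :=
    Finset.sum_sdiff_sub_sum_sdiff
  have hne : x ≠ u := by rintro rfl; exact lt_irrefl _ hux
  by_cases hxu : G.Adj x u
  · have h1 : ∑ b ∈ s \ t, f b ≤ ∑ b ∈ {u, y}, f b := by
      refine Finset.sum_le_sum_of_subset_of_nonneg ?_ fun b _ _ => (hpos b).le
      intro b hb
      simp only [s, t, mem_sdiff, mem_filter, mem_univ, true_and] at hb
      simp only [mem_insert, mem_singleton]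
      exact or_iff_not_imp_left.2 (hcon b hb.1 hb.2)
    have h2 : ∑ b ∈ {x, v}, f b ≤ ∑ b ∈ t \ s, f b := by
      refine Finset.sum_le_sum_of_subset_of_nonneg ?_ fun b _ _ => (hpos b).le
      intro b hb
      rw [mem_insert, mem_singleton] at hb
      rcases hb with rfl | rfl
      · simp [s, t, hxu.symm]
      · exact mem_sdiff.2 ⟨hvt, hvs⟩
    rw [Finset.sum_pair hxv] at h2
    have h3 : ∑ b ∈ ({u, y} : Finset V), f b ≤ f u + f y := by
      by_cases huy : u = y
      · subst huy; simpa using (hpos u).le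
      · rw [Finset.sum_pair huy]
    linarith
  · have h1 : ∑ b ∈ s \ t, f b ≤ ∑ b ∈ {y}, f b := by
      refine Finset.sum_le_sum_of_subset_of_nonneg ?_ fun b _ _ => (hpos b).le
      intro b hb
      simp only [s, t, mem_sdiff, mem_filter, mem_univ, true_and] at hb
      rw [mem_singleton]
      exact hcon b hb.1 hb.2 (by rintro rfl; exact hxu hb.1)
    have h2 : f v ≤ ∑ b ∈ t \ s, f b :=
      Finset.single_le_sum (f := f) (fun b _ => (hpos b).le) (mem_sdiff.2 ⟨hvt, hvs⟩)
    rw [Finset.sum_singleton] at h1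
    have h4 : 0 < specRad G := by
      have : 0 < ∑ b ∈ t, f b := Finset.sum_pos (fun b _ => hpos b) ⟨v, hvt⟩
      rw [hu] at this
      exact pos_of_mul_pos_left this (hpos u).le
    have := mul_lt_mul_of_pos_left hux h4
    linarith

/-- Some neighbor `w` of `x` outside the closed neighborhood of `u` yields a connected graph. -/
lemma exists_switched_connected [Fintype V] {G : SimpleGraph V} (hconn : G.Connected)
    {f : V → ℝ} (hf : IsPerronVector G f) {u v x : V} (hxv : x ≠ v)
    (hvu : G.Adj v u) (hvx : ¬ G.Adj v x) (hux : f u < f x)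
    (hnbr : ∀ w : V, G.Adj x w → f w ≤ f v) :
    ∃ w, G.Adj x w ∧ ¬ G.Adj u w ∧ w ≠ u ∧ (switched G v u x w).Connected := by
  classical
  have hxu : x ≠ u := by rintro rfl; exact lt_irrefl _ hux
  have hadj_vx : ∀ w, (switched G v u x w).Reachable v x := fun w =>
    SimpleGraph.Adj.reachable (by
      rw [switched, SimpleGraph.fromEdgeSet_adj]
      exact ⟨by simp, hxv.symm⟩)
  have hadj_uw : ∀ w, w ≠ u → (switched G v u x w).Reachable u w := fun w hw =>
    SimpleGraph.Adj.reachable (by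
      rw [switched, SimpleGraph.fromEdgeSet_adj]
      exact ⟨by simp, hw.symm⟩)
  by_cases hA : ∃ p : G.Walk x u, p.IsPath ∧ s(v, u) ∉ p.edges
  · obtain ⟨p, hp, hpe⟩ := hA
    cases p with
    | nil => exact absurd rfl hxu
    | @cons _ y _ hxy q =>
      rw [SimpleGraph.Walk.cons_isPath_iff] at hp
      obtain ⟨w, hxw, huw, hwu, hwy⟩ := exists_neighbor_ne hf hxv hvu hvx hux (hnbr y hxy)
      have hr : (switched G v u x w).Reachable x u := by
        refine switched_reachable_of_walk (SimpleGraph.Walk.cons hxy q) hpe ?_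
        rw [SimpleGraph.Walk.edges_cons, List.mem_cons, not_or]
        refine ⟨?_, fun h => hp.2 (q.fst_mem_support_of_mem_edges h)⟩
        simp [hwy, hxw.ne.symm]
      exact ⟨w, hxw, huw, hwu, switched_connected hconn ((hadj_vx w).trans hr)
        (hr.trans (hadj_uw w hwu))⟩
  · obtain ⟨p, hp⟩ := (hconn x v).exists_isPath
    have hpe : s(v, u) ∉ p.edges := by
      intro h
      have hu := p.snd_mem_support_of_mem_edges h
      refine hA ⟨p.takeUntil u hu, hp.takeUntil hu, fun h' => ?_⟩
      exact SimpleGraph.Walk.endpoint_notMem_support_takeUntil hp hu hvu.ne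
        (SimpleGraph.Walk.fst_mem_support_of_mem_edges _ h')
    cases p with
    | nil => exact absurd rfl hxv
    | @cons _ y _ hxy q =>
      rw [SimpleGraph.Walk.cons_isPath_iff] at hp
      have hyv : y ≠ v := by rintro rfl; exact hvx hxy.symm
      have hyu : y ≠ u := by
        rintro rfl
        refine hA ⟨hxy.toWalk, by simp [hxu], ?_⟩
        simp [hxv.symm, hvu.ne]
      have huy : ¬ G.Adj u y := by
        intro h
        refine hA ⟨SimpleGraph.Walk.cons hxy (SimpleGraph.Walk.cons h.symm .nil), ?_, ?_⟩
        · simp [SimpleGraph.Walk.cons_isPath_iff, hyu, hxy.ne, hxu]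
        · simp [hyv.symm, hxv.symm, hvu.ne]
      have hr : (switched G v u x y).Reachable v y := by
        refine (switched_reachable_of_walk q (fun h => hpe ?_) fun h => hp.2 ?_).symm
        · rw [SimpleGraph.Walk.edges_cons]
          exact List.mem_cons_of_mem _ h
        · exact q.fst_mem_support_of_mem_edges h
      exact ⟨y, hxy, huy, hyu, switched_connected hconn (hr.trans (hadj_uw y hyu).symm)
        ((hadj_vx y).symm.trans hr)⟩

/-- (Switching test.) If the Perron vector `f` of a connected graph
`G` admits vertices `u, v, x` with `vu ∈ E`, `vx ∉ E`, `f(u) < f(x) ≤ f(v)`, and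
`f(v) ≥ f(w)` for all neighbors `w` of `x`, then `G` does not have greatest spectral
radius among connected graphs with its degree sequence. -/
theorem switching_test [Fintype V] [DecidableEq V]
    (G : SimpleGraph V) (hconn : G.Connected)
    (f : V → ℝ) (hf : IsPerronVector G f) (u v x : V) (hxv : x ≠ v)
    (hvu : G.Adj v u) (hvx : ¬ G.Adj v x)
    (hux : f u < f x) (hxvle : f x ≤ f v)
    (hnbr : ∀ w : V, G.Adj x w → f w ≤ f v) :
    ∃ G' : SimpleGraph V, G'.Connected ∧ degMultiset G' = degMultiset G ∧
      specRad G < specRad G' := by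
  obtain ⟨w, hxw, huw, hwu, hG'⟩ := exists_switched_connected hconn hf hxv hvu hvx hux hnbr
  have hxu : x ≠ u := by rintro rfl; exact lt_irrefl _ hux
  have hvw : v ≠ w := by rintro rfl; exact hvx hxw.symm
  have hmul := adjMat_mulVec_switched hvu hxw hvx huw hxv hxu hwu
  refine ⟨switched G v u x w, hG', ?_, ?_⟩
  · have hdeg : deg (switched G v u x w) = deg G := by
      ext a
      have h := congrFun (hmul fun _ => 1) a
      simp only [sub_self, Pi.single_zero, add_zero] at h
      rw [adjMat_mulVec_one, adjMat_mulVec_one] at h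
      exact_mod_cast h
    rw [degMultiset, degMultiset, hdeg]
  · by_contra! hle
    have heig := mulVec_eq_of_specRad_le _ hle (g := f) (by
      rw [hmul, hf.2.2]
      simp only [dotProduct_add, dotProduct_smul, dotProduct_single, smul_eq_mul]
      nlinarith [mul_nonneg (sub_nonneg.2 (hnbr w hxw)) (sub_nonneg.2 hux.le)])
    rw [hmul, hf.2.2, add_eq_left] at heig
    have h := congrFun heig v
    simp [hvu.ne, hxv.symm, hvw] at h
    linarith
end

section
/- There exist two non-isomorphic connected graphs G1 and G2, both having degree sequence π = (4,4,3,3,2,1,1) and both admitting a BFD-ordering consistent with their respective Perron vectors (f(u) > f(v) implies u ≺ v), such that λ(G1) < λ(G2). In particular, the BFD-ordering condition of the paper's main theorem is necessary but not sufficient for a connected graph to have greatest spectral radius among connected graphs with its degree sequence. -/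
open Finset

variable {V : Type*} {W : Type*}

theorem deg_eq_degree [Fintype V] (G : SimpleGraph V) [DecidableRel G.Adj] (v : V) :
    deg G v = G.degree v := by
  unfold deg
  congr!

theorem adjMat_mulVec_apply [Fintype V] (G : SimpleGraph V) [DecidableRel G.Adj] (f : V → ℝ)
    (v : V) : (adjMat G).mulVec f v = ∑ u, if G.Adj v u then f u else 0 := by
  simp [adjMat, Matrix.mulVec, dotProduct, SimpleGraph.adjMatrix_apply]

/-- An eigenvalue of the adjacency matrix with a positive eigenvector is the spectral radius. -/
theorem specRad_eq_of_pos_eigenvector [Fintype V] [Nonempty V] {G : SimpleGraph V} {g : V → ℝ}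
    {r : ℝ} (hpos : ∀ v, 0 < g v) (hg : (adjMat G).mulVec g = r • g) : specRad G = r := by
  classical
  refine IsGreatest.csSup_eq ⟨⟨g, ?_, hg⟩, ?_⟩
  · intro h
    obtain ⟨v⟩ := ‹Nonempty V›
    exact (hpos v).ne' (congrFun h v)
  rintro μ ⟨f, hf, hfμ⟩
  obtain ⟨w, hw⟩ := Function.ne_iff.mp hf
  have hsum : 0 < ∑ v, g v * |f v| :=
    Finset.sum_pos' (fun v _ => mul_nonneg (hpos v).le (abs_nonneg _))
      ⟨w, Finset.mem_univ w, mul_pos (hpos w) (abs_pos.mpr hw)⟩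
  have hbound (v : V) : μ * |f v| ≤ ∑ u, if G.Adj v u then |f u| else 0 := by
    have h := congrFun hfμ v
    rw [adjMat_mulVec_apply] at h
    calc μ * |f v| ≤ |μ| * |f v| := by gcongr; exact le_abs_self μ
      _ = |∑ u, if G.Adj v u then f u else 0| := by rw [h]; simp [abs_mul]
      _ ≤ ∑ u, |if G.Adj v u then f u else 0| := Finset.abs_sum_le_sum_abs _ _
      _ = _ := Finset.sum_congr rfl fun u _ => by split_ifs <;> simp
  refine le_of_mul_le_mul_right ?_ hsum
  calc μ * ∑ v, g v * |f v| = ∑ v, g v * (μ * |f v|) := by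
        rw [Finset.mul_sum]; exact Finset.sum_congr rfl fun v _ => by ring
    _ ≤ ∑ v, g v * ∑ u, (if G.Adj v u then |f u| else 0) :=
        Finset.sum_le_sum fun v _ => mul_le_mul_of_nonneg_left (hbound v) (hpos v).le
    _ = ∑ u, |f u| * ∑ v, (if G.Adj u v then g v else 0) := by
        simp_rw [Finset.mul_sum]
        rw [Finset.sum_comm]
        refine Finset.sum_congr rfl fun u _ => Finset.sum_congr rfl fun v _ => ?_
        simp only [G.adj_comm u v, mul_ite, mul_zero, mul_comm]
    _ = r * ∑ v, g v * |f v| := by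
        rw [Finset.mul_sum]
        refine Finset.sum_congr rfl fun u _ => ?_
        have h := congrFun hg u
        rw [adjMat_mulVec_apply] at h
        rw [h, Pi.smul_apply, smul_eq_mul]
        ring

/-- Normalizing a positive eigenvector yields the Perron vector. -/
theorem isPerronVector_normalize [Fintype V] [Nonempty V] {G : SimpleGraph V} {g : V → ℝ}
    {r : ℝ} (hpos : ∀ v, 0 < g v) (hg : (adjMat G).mulVec g = r • g) :
    IsPerronVector G ((√(∑ v, g v ^ 2))⁻¹ • g) := by
  have hsum : 0 < ∑ v, g v ^ 2 :=
    Finset.sum_pos (fun v _ => pow_pos (hpos v) 2) Finset.univ_nonempty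
  refine ⟨fun v => mul_pos (inv_pos.mpr (Real.sqrt_pos.mpr hsum)) (hpos v), ?_, ?_⟩
  · simp only [Pi.smul_apply, smul_eq_mul, mul_pow, ← Finset.mul_sum, inv_pow,
      Real.sq_sqrt hsum.le]
    exact inv_mul_cancel₀ hsum.ne'
  · rw [Matrix.mulVec_smul, hg, specRad_eq_of_pos_eigenvector hpos hg, smul_comm]

/-- If the identity ordering has non-increasing degrees and `p` is a monotone map sending each
non-root vertex to its least neighbour one layer closer to the root, then it is a BFD-ordering. -/
theorem isBFDOrdering_finCongr {n : ℕ} {G : SimpleGraph (Fin (n + 1))} [DecidableRel G.Adj]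
    {D : Fin (n + 1) → ℕ} {p : Fin (n + 1) → Fin (n + 1)}
    (hD : ∀ v, G.dist 0 v = D v) (hDmono : Monotone D) (hpmono : Monotone p)
    (hp : ∀ v, v ≠ 0 → G.Adj (p v) v ∧ D (p v) + 1 = D v)
    (hpmin : ∀ w v, G.Adj w v → D w + 1 = D v → p v ≤ w)
    (hdeg : Antitone fun v => G.degree v) :
    IsBFDOrdering G (finCongr (Fintype.card_fin (n + 1)).symm) := by
  have hroot : (finCongr (Fintype.card_fin (n + 1)).symm).symm ⟨0, Fintype.card_pos⟩ = 0 := rfl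
  have hle (u v : Fin (n + 1)) : finCongr (Fintype.card_fin (n + 1)).symm u ≤
      finCongr (Fintype.card_fin (n + 1)).symm v ↔ u ≤ v := Iff.rfl
  have hlt (u v : Fin (n + 1)) : finCongr (Fintype.card_fin (n + 1)).symm u <
      finCongr (Fintype.card_fin (n + 1)).symm v ↔ u < v := Iff.rfl
  have hpar (w v : Fin (n + 1))
      (h : IsParent G (finCongr (Fintype.card_fin (n + 1)).symm) w v) : w = p v := by
    obtain ⟨hadj, hdist, hmin⟩ := h
    simp only [hroot, hD, hle] at hdist hmin
    have hv : v ≠ 0 := by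
      rintro rfl
      have h0 := hD 0
      rw [SimpleGraph.dist_self] at h0
      omega
    exact le_antisymm (hmin _ (hp v hv).1 (hp v hv).2) (hpmin w v hadj hdist)
  refine ⟨fun u v h => ?_, fun w1 w2 v1 v2 h h1 h2 => ?_, fun u v h => ?_⟩
  · simpa only [hroot, hD] using hDmono h
  · rw [hlt, hpar _ _ h1, hpar _ _ h2] at h
    exact hpmono.reflect_lt h
  · simpa only [deg_eq_degree] using hdeg ((hlt u v).mp h).le

theorem dist_eq_two {G : SimpleGraph V} {u v w : V} (huw : G.Adj u w) (hwv : G.Adj w v)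
    (hne : u ≠ v) (hadj : ¬ G.Adj u v) : G.dist u v = 2 := by
  have hle : G.dist u v ≤ 2 :=
    G.dist_le (SimpleGraph.Walk.cons huw (SimpleGraph.Walk.cons hwv SimpleGraph.Walk.nil))
  have h0 : G.dist u v ≠ 0 := fun h =>
    hne ((SimpleGraph.Reachable.dist_eq_zero_iff ⟨huw.toWalk.append hwv.toWalk⟩).mp h)
  have h1 : G.dist u v ≠ 1 := fun h => hadj (SimpleGraph.dist_eq_one_iff_adj.mp h)
  omega

/-- The graph whose edges are the pairs in a list. -/
def graphOfList (l : List (Fin 7 × Fin 7)) : SimpleGraph (Fin 7) :=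
  SimpleGraph.fromRel fun u v => (u, v) ∈ l

instance (l : List (Fin 7 × Fin 7)) : DecidableRel (graphOfList l).Adj := fun u v =>
  inferInstanceAs (Decidable (u ≠ v ∧ ((u, v) ∈ l ∨ (v, u) ∈ l)))

/-- The member of the pair with the smaller spectral radius. -/
abbrev smallGraph : SimpleGraph (Fin 7) :=
  graphOfList [(0, 1), (0, 2), (0, 3), (0, 4), (1, 2), (1, 3), (1, 4), (2, 5), (3, 6)]

/-- The member of the pair with the larger spectral radius. -/
abbrev largeGraph : SimpleGraph (Fin 7) :=
  graphOfList [(0, 1), (0, 2), (0, 3), (0, 4), (1, 2), (1, 3), (1, 5), (2, 3), (4, 6)]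

theorem smallGraph_dist (v : Fin 7) :
    smallGraph.dist 0 v = (![0, 1, 1, 1, 1, 2, 2] : Fin 7 → ℕ) v := by
  fin_cases v
  · exact SimpleGraph.dist_self
  · exact SimpleGraph.dist_eq_one_iff_adj.mpr (by decide)
  · exact SimpleGraph.dist_eq_one_iff_adj.mpr (by decide)
  · exact SimpleGraph.dist_eq_one_iff_adj.mpr (by decide)
  · exact SimpleGraph.dist_eq_one_iff_adj.mpr (by decide)
  · exact dist_eq_two (w := 2) (by decide) (by decide) (by decide) (by decide)
  · exact dist_eq_two (w := 3) (by decide) (by decide) (by decide) (by decide)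

theorem smallGraph_connected : smallGraph.Connected := by
  refine SimpleGraph.connected_iff_exists_forall_reachable _ |>.mpr ⟨0, fun v => ?_⟩
  by_contra h
  have hdist := SimpleGraph.dist_eq_zero_of_not_reachable h
  rw [smallGraph_dist] at hdist
  have hv : v = 0 := by
    revert v
    decide
  subst hv
  exact h (SimpleGraph.Reachable.refl 0)

theorem smallGraph_degMultiset :
    degMultiset smallGraph = ({4, 4, 3, 3, 2, 1, 1} : Multiset ℕ) := by
  rw [degMultiset, funext (deg_eq_degree smallGraph)]
  decide

theorem smallGraph_isBFDOrdering :
    IsBFDOrdering smallGraph (finCongr (Fintype.card_fin 7).symm) :=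
  isBFDOrdering_finCongr smallGraph_dist (p := ![0, 0, 0, 0, 0, 2, 3]) (by decide)
    (by decide) (by decide) (by decide) (by unfold Antitone; decide)

theorem largeGraph_dist (v : Fin 7) :
    largeGraph.dist 0 v = (![0, 1, 1, 1, 1, 2, 2] : Fin 7 → ℕ) v := by
  fin_cases v
  · exact SimpleGraph.dist_self
  · exact SimpleGraph.dist_eq_one_iff_adj.mpr (by decide)
  · exact SimpleGraph.dist_eq_one_iff_adj.mpr (by decide)
  · exact SimpleGraph.dist_eq_one_iff_adj.mpr (by decide)
  · exact SimpleGraph.dist_eq_one_iff_adj.mpr (by decide)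
  · exact dist_eq_two (w := 1) (by decide) (by decide) (by decide) (by decide)
  · exact dist_eq_two (w := 4) (by decide) (by decide) (by decide) (by decide)

theorem largeGraph_connected : largeGraph.Connected := by
  refine SimpleGraph.connected_iff_exists_forall_reachable _ |>.mpr ⟨0, fun v => ?_⟩
  by_contra h
  have hdist := SimpleGraph.dist_eq_zero_of_not_reachable h
  rw [largeGraph_dist] at hdist
  have hv : v = 0 := by
    revert v
    decide
  subst hv
  exact h (SimpleGraph.Reachable.refl 0)

theorem largeGraph_degMultiset :
    degMultiset largeGraph = ({4, 4, 3, 3, 2, 1, 1} : Multiset ℕ) := by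
  rw [degMultiset, funext (deg_eq_degree largeGraph)]
  decide

theorem largeGraph_isBFDOrdering :
    IsBFDOrdering largeGraph (finCongr (Fintype.card_fin 7).symm) :=
  isBFDOrdering_finCongr largeGraph_dist (p := ![0, 0, 0, 0, 0, 1, 4]) (by decide)
    (by decide) (by decide) (by decide) (by unfold Antitone; decide)

theorem smallGraph_eigenvector {r : ℝ} (hr : r ∈ Set.Ioo (3 : ℝ) 3.1)
    (h : r ^ 4 - r ^ 3 - 7 * r ^ 2 + r + 2 = 0) :
    ∃ g : Fin 7 → ℝ, (∀ v, 0 < g v) ∧ Antitone g ∧ (adjMat smallGraph).mulVec g = r • g := by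
  obtain ⟨hl, hu⟩ := hr
  have hanti : Antitone (![r * (r ^ 2 - 1), r * (r ^ 2 - 1), 2 * r ^ 2, 2 * r ^ 2,
      2 * (r ^ 2 - 1), 2 * r, 2 * r] : Fin 7 → ℝ) := by
    refine Fin.antitone_iff_succ_le.mpr fun i => ?_
    fin_cases i <;> simp <;> nlinarith [mul_pos (sub_pos.mpr hl) (sub_pos.mpr hl)]
  refine ⟨_, fun v => lt_of_lt_of_le ?_ (hanti (Fin.le_last v)), hanti, ?_⟩
  · change 0 < 2 * r
    linarith
  · ext v
    rw [adjMat_mulVec_apply]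
    fin_cases v <;> simp [Fin.sum_univ_succ, graphOfList] <;> linarith

theorem largeGraph_eigenvector {r : ℝ} (hr : r ∈ Set.Ioo (3.1 : ℝ) 3.2)
    (h : r ^ 6 - r ^ 5 - 8 * r ^ 4 + 11 * r ^ 2 + r - 2 = 0) :
    ∃ g : Fin 7 → ℝ, (∀ v, 0 < g v) ∧ Antitone g ∧ (adjMat largeGraph).mulVec g = r • g := by
  obtain ⟨hl, hu⟩ := hr
  have hanti : Antitone (![2 * (r ^ 2 - 1) * (r ^ 2 + r - 1), 2 * r * (r ^ 3 + r ^ 2 - 2 * r - 1),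
      (r ^ 2 - 1) * (r ^ 3 - 3 * r), (r ^ 2 - 1) * (r ^ 3 - 3 * r), 2 * r * (r ^ 2 + r - 1),
      2 * (r ^ 3 + r ^ 2 - 2 * r - 1), 2 * (r ^ 2 + r - 1)] : Fin 7 → ℝ) := by
    obtain ⟨s, rfl⟩ : ∃ s, r = 3.1 + s := ⟨r - 3.1, by ring⟩
    have hs : 0 < s := by linarith
    have hs' : s < 0.1 := by linarith
    have hpow (k : ℕ) : 0 ≤ s ^ k * (0.1 - s) := by
      have : 0 < 0.1 - s := by linarith
      positivity
    refine Fin.antitone_iff_succ_le.mpr fun i => ?_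
    fin_cases i <;> simp <;>
      nlinarith [hpow 1, hpow 2, hpow 3, hpow 4, pow_pos hs 2, pow_pos hs 3, pow_pos hs 4,
        pow_pos hs 5]
  refine ⟨_, fun v => lt_of_lt_of_le ?_ (hanti (Fin.le_last v)), hanti, ?_⟩
  · change 0 < 2 * (r ^ 2 + r - 1)
    nlinarith
  · ext v
    rw [adjMat_mulVec_apply]
    fin_cases v <;> simp [Fin.sum_univ_succ, graphOfList] <;> linarith

theorem not_nonempty_iso_smallGraph_largeGraph : ¬ Nonempty (smallGraph ≃g largeGraph) := by
  rintro ⟨φ⟩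
  have key : ∀ u v, smallGraph.Adj u v → smallGraph.degree u = 1 → smallGraph.degree v ≠ 2 := by
    decide
  refine key (φ.symm 6) (φ.symm 4) (φ.symm.map_adj_iff.mpr (by decide)) ?_ ?_
  · rw [φ.symm.degree_eq]
    decide
  · rw [φ.symm.degree_eq]
    decide

/-- A positive non-increasing eigenvector yields a Perron vector consistent with the identity
ordering. -/
theorem exists_isPerronVector_of_antitone {n : ℕ} {G : SimpleGraph (Fin (n + 1))}
    {g : Fin (n + 1) → ℝ} {r : ℝ} (hpos : ∀ v, 0 < g v) (hanti : Antitone g)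
    (hg : (adjMat G).mulVec g = r • g) :
    ∃ f, IsPerronVector G f ∧ ∀ u v, f v < f u → u < v := by
  refine ⟨_, isPerronVector_normalize hpos hg, fun u v h => ?_⟩
  by_contra! hvu
  exact h.not_ge (mul_le_mul_of_nonneg_left (hanti hvu) (by positivity))

/-- There are two non-isomorphic connected graphs with degree
sequence `(4,4,3,3,2,1,1)`, both admitting BFD-orderings consistent with their
Perron vectors, but with different spectral radii: the BFD condition is necessary
but not sufficient for maximality of the spectral radius. -/
theorem bfd_not_sufficient :
    ∃ G1 G2 : SimpleGraph (Fin 7),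
      G1.Connected ∧ G2.Connected ∧
      degMultiset G1 = ({4, 4, 3, 3, 2, 1, 1} : Multiset ℕ) ∧
      degMultiset G2 = ({4, 4, 3, 3, 2, 1, 1} : Multiset ℕ) ∧
      ¬ Nonempty (G1 ≃g G2) ∧
      (∃ f1 : Fin 7 → ℝ, IsPerronVector G1 f1 ∧
        ∃ ord : Fin 7 ≃ Fin (Fintype.card (Fin 7)), IsBFDOrdering G1 ord ∧
          ∀ u v : Fin 7, f1 v < f1 u → ord u < ord v) ∧
      (∃ f2 : Fin 7 → ℝ, IsPerronVector G2 f2 ∧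
        ∃ ord : Fin 7 ≃ Fin (Fintype.card (Fin 7)), IsBFDOrdering G2 ord ∧
          ∀ u v : Fin 7, f2 v < f2 u → ord u < ord v) ∧
      specRad G1 < specRad G2 := by
  obtain ⟨r, hr, hr0⟩ : ∃ r ∈ Set.Ioo (3 : ℝ) 3.1, r ^ 4 - r ^ 3 - 7 * r ^ 2 + r + 2 = 0 :=
    intermediate_value_Ioo (by norm_num)
      (f := fun x : ℝ => x ^ 4 - x ^ 3 - 7 * x ^ 2 + x + 2) (by fun_prop)
      (by constructor <;> norm_num)
  obtain ⟨s, hs, hs0⟩ : ∃ s ∈ Set.Ioo (3.1 : ℝ) 3.2,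
      s ^ 6 - s ^ 5 - 8 * s ^ 4 + 11 * s ^ 2 + s - 2 = 0 :=
    intermediate_value_Ioo (by norm_num)
      (f := fun x : ℝ => x ^ 6 - x ^ 5 - 8 * x ^ 4 + 11 * x ^ 2 + x - 2) (by fun_prop)
      (by constructor <;> norm_num)
  obtain ⟨g1, hpos1, hanti1, hg1⟩ := smallGraph_eigenvector hr hr0
  obtain ⟨g2, hpos2, hanti2, hg2⟩ := largeGraph_eigenvector hs hs0
  obtain ⟨f1, hf1, hord1⟩ := exists_isPerronVector_of_antitone hpos1 hanti1 hg1
  obtain ⟨f2, hf2, hord2⟩ := exists_isPerronVector_of_antitone hpos2 hanti2 hg2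
  refine ⟨smallGraph, largeGraph, smallGraph_connected, largeGraph_connected,
    smallGraph_degMultiset, largeGraph_degMultiset, not_nonempty_iso_smallGraph_largeGraph,
    ⟨f1, hf1, _, smallGraph_isBFDOrdering, hord1⟩,
    ⟨f2, hf2, _, largeGraph_isBFDOrdering, hord2⟩, ?_⟩
  rw [specRad_eq_of_pos_eigenvector hpos1 hg1, specRad_eq_of_pos_eigenvector hpos2 hg2]
  exact hr.2.trans hs.1
end
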